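/- The set PP(a,b,c) of weakly increasing a-tuples (s_1 ≤ s_2 ≤ ... ≤ s_a) of b-element subsets of {1,...,b+c} (ordered pointwise: s ≤ s' iff s_i ≤ s'_i for all i) has cardinality equal to the MacMahon box formula ∏_{i=1}^{a} ∏_{j=1}^{b} ∏_{k=1}^{c} (i+j+k-1)/(i+j+k-2). -/

import Mathlib

open Finset in
/-- The weakly increasing sequences of natural numbers bounded pointwise by `μ`. -/
noncomputable def monotoneBelow {b : ℕ} (μ : Fin b → ℕ) : Finset (Fin b → ℕ) :=
  open Classical in {s ∈ Iic μ | Monotone s}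

open Finset in
/-- The weakly increasing `a`-tuples of weakly increasing sequences bounded pointwise by `μ`. -/
noncomputable def chainsBelow (a : ℕ) {b : ℕ} (μ : Fin b → ℕ) : Finset (Fin a → Fin b → ℕ) :=
  open Classical in {S ∈ Iic (fun _ => μ) | Monotone S ∧ ∀ l, Monotone (S l)}

theorem mem_monotoneBelow {b : ℕ} {μ s : Fin b → ℕ} :
    s ∈ monotoneBelow μ ↔ s ≤ μ ∧ Monotone s := by
  simp [monotoneBelow]

theorem mem_chainsBelow {a b : ℕ} {μ : Fin b → ℕ} {S : Fin a → Fin b → ℕ} :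
    S ∈ chainsBelow a μ ↔ (∀ l, S l ≤ μ) ∧ Monotone S ∧ ∀ l, Monotone (S l) := by
  simp [chainsBelow, Pi.le_def]

theorem monotone_snoc_iff {α : Type*} [Preorder α] {n : ℕ} (p : Fin n → α) (x : α) :
    Monotone (Fin.snoc p x : Fin (n + 1) → α) ↔ Monotone p ∧ ∀ i, p i ≤ x := by
  refine ⟨fun h => ⟨fun i j hij => ?_, fun i => ?_⟩, fun ⟨h, hx⟩ i j hij => ?_⟩
  · simpa using h (Fin.castSucc_le_castSucc_iff.2 hij)
  · simpa using h (Fin.le_last i.castSucc)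
  · induction j using Fin.lastCases with
    | last =>
      induction i using Fin.lastCases with
      | last => simp
      | cast i => simpa using hx i
    | cast j =>
      induction i using Fin.lastCases with
      | last => exact absurd (lt_of_le_of_lt hij (Fin.castSucc_lt_last j)) (lt_irrefl _)
      | cast i => simpa using h (Fin.castSucc_le_castSucc_iff.1 hij)

open Finset in
theorem sum_monotoneBelow_succ {M : Type*} [AddCommMonoid M] {b : ℕ} {μ : Fin (b + 1) → ℕ}
    (g : (Fin (b + 1) → ℕ) → M) :
    ∑ s ∈ monotoneBelow μ, g s =
      ∑ s ∈ monotoneBelow (Fin.init μ), ∑ x ∈ Icc (univ.sup s) (μ (Fin.last b)),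
        g (Fin.snoc s x) := by
  rw [sum_sigma']
  refine sum_bij' (fun s _ => ⟨Fin.init s, s (Fin.last b)⟩) (fun p _ => Fin.snoc p.1 p.2)
    ?_ ?_ ?_ ?_ ?_
  · intro s hs
    obtain ⟨h1, h2⟩ := mem_monotoneBelow.1 hs
    rw [← Fin.snoc_init_self s, monotone_snoc_iff] at h2
    simp only [mem_sigma, mem_monotoneBelow, mem_Icc, Finset.sup_le_iff]
    exact ⟨⟨fun i => h1 _, h2.1⟩, fun i _ => h2.2 i, h1 _⟩
  · rintro ⟨s, x⟩ h
    simp only [mem_sigma, mem_monotoneBelow, mem_Icc, Finset.sup_le_iff] at h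
    refine mem_monotoneBelow.2 ⟨fun i => ?_, (monotone_snoc_iff _ _).2
      ⟨h.1.2, fun i => h.2.1 i (mem_univ i)⟩⟩
    induction i using Fin.lastCases with
    | last => simpa using h.2.2
    | cast i =>
      rw [Fin.snoc_castSucc]
      exact h.1.1 i
  · intro s _
    exact Fin.snoc_init_self s
  · rintro ⟨s, x⟩ _
    simp
  · intro s _
    simp [Fin.snoc_init_self]

/-- Fixing the last argument of an alternating map. -/
def AlternatingMap.fixLast {R V N : Type*} [CommRing R] [AddCommGroup V] [Module R V]
    [AddCommGroup N] [Module R N] {b : ℕ} (D : V [⋀^Fin (b + 1)]→ₗ[R] N) (v : V) :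
    V [⋀^Fin b]→ₗ[R] N where
  toFun g := D (Fin.snoc g v)
  map_update_add' {inst} g i x y := by
    obtain rfl : inst = instDecidableEqFin b := Subsingleton.elim _ _
    simp only [Fin.snoc_update, D.map_update_add]
  map_update_smul' {inst} g i c x := by
    obtain rfl : inst = instDecidableEqFin b := Subsingleton.elim _ _
    simp only [Fin.snoc_update, D.map_update_smul]
  map_eq_zero_of_eq' g i j h hij :=
    D.map_eq_zero_of_eq _ (i := i.castSucc) (j := j.castSucc) (by simpa using h) (by simpa using hij)

theorem AlternatingMap.fixLast_apply {R V N : Type*} [CommRing R] [AddCommGroup V] [Module R V]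
    [AddCommGroup N] [Module R N] {b : ℕ} (D : V [⋀^Fin (b + 1)]→ₗ[R] N) (v : V) (g : Fin b → V) :
    D.fixLast v g = D (Fin.snoc g v) := rfl

open Finset in
theorem AlternatingMap.map_snoc_sum {R V N ι : Type*} [CommRing R] [AddCommGroup V] [Module R V]
    [AddCommGroup N] [Module R N] {b : ℕ} (D : V [⋀^Fin (b + 1)]→ₗ[R] N) (g : Fin b → V)
    (t : Finset ι) (v : ι → V) :
    D (Fin.snoc g (∑ i ∈ t, v i)) = ∑ i ∈ t, D (Fin.snoc g (v i)) := by
  have := D.map_update_sum (t := t) (Fin.last b) v (Fin.snoc g 0)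
  simpa only [Fin.update_snoc_last] using this

open Finset in
/-- Summing an alternating map over weakly increasing sequences below `μ`, one argument at a time:
if `F i` is a partial sum of `f i` whose lower boundary term is `f (i - 1)`, the boundary terms
cancel. -/
theorem sum_monotoneBelow_alternating {R V N : Type*} [CommRing R] [AddCommGroup V] [Module R V]
    [AddCommGroup N] [Module R N] (f F : ℕ → ℕ → V)
    (h_zero : ∀ m, ∑ x ∈ Icc 0 m, f 0 x = F 0 m)
    (h_succ : ∀ i l m, l ≤ m → ∑ x ∈ Icc l m, f (i + 1) x = F (i + 1) m - f i l)
    {b : ℕ} (D : V [⋀^Fin b]→ₗ[R] N) (μ : Fin b → ℕ) (hμ : Monotone μ) :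
    ∑ s ∈ monotoneBelow μ, D (fun i => f i (s i)) = D (fun i => F i (μ i)) := by
  induction b with
  | zero =>
    have : monotoneBelow μ = {μ} := by
      ext s
      simp [mem_monotoneBelow, Subsingleton.elim s μ, hμ]
    rw [this, sum_singleton]
    exact congrArg D (Subsingleton.elim _ _)
  | succ b ih =>
    have snoc_eq (h : ℕ → ℕ → V) (s : Fin b → ℕ) (x : ℕ) :
        (fun i : Fin (b + 1) => h i ((Fin.snoc s x : Fin (b + 1) → ℕ) i)) =
          Fin.snoc (fun i : Fin b => h i (s i)) (h b x) := by
      ext i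
      induction i using Fin.lastCases <;> simp
    have hinit : Monotone (Fin.init μ) := fun i j hij => hμ (Fin.castSucc_le_castSucc_iff.2 hij)
    have inner (s : Fin b → ℕ) (hs : s ∈ monotoneBelow (Fin.init μ)) :
        ∑ x ∈ Icc (univ.sup s) (μ (Fin.last b)),
          D (fun i => f i ((Fin.snoc s x : Fin (b + 1) → ℕ) i)) =
        D.fixLast (F b (μ (Fin.last b))) (fun i => f i (s i)) := by
      obtain ⟨h1, h2⟩ := mem_monotoneBelow.1 hs
      simp only [snoc_eq, AlternatingMap.fixLast_apply]
      rw [← D.map_snoc_sum _ _ (f b)]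
      cases b with
      | zero => simp [h_zero]
      | succ b =>
        have hsup : univ.sup s = s (Fin.last b) :=
          le_antisymm (Finset.sup_le fun i _ => h2 (Fin.le_last i)) (Finset.le_sup (mem_univ _))
        have hle : s (Fin.last b) ≤ μ (Fin.last (b + 1)) :=
          (h1 _).trans (hμ (Fin.le_last _))
        rw [hsup, h_succ _ _ _ hle, ← sub_eq_zero]
        have key : D (Fin.snoc (fun i : Fin (b + 1) => f i (s i)) (f b (s (Fin.last b)))) = 0 :=
          D.map_eq_zero_of_eq _ (i := (Fin.last b).castSucc) (j := Fin.last (b + 1)) (by simp)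
            (Fin.castSucc_lt_last _).ne
        have split := D.map_update_sub
          (Fin.snoc (fun i : Fin (b + 1) => f i (s i)) 0) (Fin.last (b + 1))
          (F (b + 1) (μ (Fin.last (b + 1)))) (f b (s (Fin.last b)))
        simp only [Fin.update_snoc_last] at split
        rw [split, key, sub_zero, sub_self]
    rw [sum_monotoneBelow_succ, sum_congr rfl inner, ih _ _ hinit, AlternatingMap.fixLast_apply]
    have := snoc_eq F (Fin.init μ) (μ (Fin.last b))
    rw [Fin.snoc_init_self] at this
    rw [this]

open Finset in
theorem card_chainsBelow_succ (a : ℕ) {b : ℕ} (μ : Fin b → ℕ) :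
    #(chainsBelow (a + 1) μ) = ∑ s ∈ monotoneBelow μ, #(chainsBelow a s) := by
  classical
  rw [card_eq_sum_card_fiberwise (f := fun S => S (Fin.last a)) (t := monotoneBelow μ)
    (fun S hS => by
      obtain ⟨h1, -, h3⟩ := mem_chainsBelow.1 (mem_coe.1 hS)
      exact mem_coe.2 (mem_monotoneBelow.2 ⟨h1 _, h3 _⟩))]
  refine sum_congr rfl fun s hs => ?_
  obtain ⟨hsμ, hs⟩ := mem_monotoneBelow.1 hs
  refine card_nbij' (fun S => Fin.init S) (fun S => Fin.snoc S s) ?_ ?_ ?_ ?_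
  · intro S hS
    obtain ⟨hmem, rfl⟩ := mem_filter.1 (mem_coe.1 hS)
    obtain ⟨h1, h2, h3⟩ := mem_chainsBelow.1 hmem
    rw [← Fin.snoc_init_self S, monotone_snoc_iff] at h2
    exact mem_coe.2 (mem_chainsBelow.2 ⟨h2.2, h2.1, fun l => h3 _⟩)
  · intro S hS
    obtain ⟨h1, h2, h3⟩ := mem_chainsBelow.1 (mem_coe.1 hS)
    refine mem_coe.2 (mem_filter.2 ⟨mem_chainsBelow.2
      ⟨fun l => ?_, (monotone_snoc_iff _ _).2 ⟨h2, h1⟩, fun l => ?_⟩, by simp⟩)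
    · induction l using Fin.lastCases with
      | last => simpa using hsμ
      | cast l => simpa using (h1 l).trans hsμ
    · induction l using Fin.lastCases with
      | last => simpa using hs
      | cast l => simpa using h3 l
  · intro S hS
    obtain ⟨-, rfl⟩ := mem_filter.1 (mem_coe.1 hS)
    exact Fin.snoc_init_self S
  · intro S _
    exact Fin.init_snoc _ _

open Finset in
theorem sum_Icc_choose_diagonal_zero (d m : ℕ) :
    ∑ x ∈ Icc 0 m, (x + d).choose x = (m + d + 1).choose m := by
  induction m with
  | zero => simp
  | succ m ih =>
    rw [← Finset.insert_Icc_right_eq_Icc_add_one (by simp), sum_insert (by simp), ih,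
      show m + 1 + d + 1 = (m + d + 1) + 1 by ring, Nat.choose_succ_succ',
      add_comm, show m + 1 + d = m + d + 1 by ring]

open Finset in
theorem sum_Icc_choose_diagonal_succ (d i l m : ℕ) (h : l ≤ m) :
    ∑ x ∈ Icc l m, (x + d).choose (x + (i + 1)) + (l + d).choose (l + i) =
      (m + d + 1).choose (m + (i + 1)) := by
  induction m, h using Nat.le_induction with
  | base =>
    rw [Icc_self, sum_singleton, show l + (i + 1) = l + i + 1 by ring, Nat.choose_succ_succ]
    ring
  | succ m hm ih =>
    rw [sum_Icc_succ_top (by lia), add_right_comm, ih,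
      show m + 1 + d + 1 = (m + d + 1) + 1 by ring, show m + 1 + (i + 1) = m + (i + 1) + 1 by ring,
      Nat.choose_succ_succ, show m + 1 + d = m + d + 1 by ring]

/-- A determinantal formula for the number of chains of length `a` below `μ`. -/
theorem card_chainsBelow_eq_det (a : ℕ) {b : ℕ} (μ : Fin b → ℕ) (hμ : Monotone μ) :
    ((chainsBelow a μ).card : ℚ) =
      (Matrix.of fun i j : Fin b => ((μ i + (a + j)).choose (μ i + i) : ℚ)).det := by
  induction a generalizing μ with
  | zero =>
    have h1 : chainsBelow 0 μ = {Fin.elim0} := by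
      ext S
      simp only [mem_chainsBelow, Finset.mem_singleton]
      exact ⟨fun _ => Subsingleton.elim _ _,
        fun _ => ⟨fun l => l.elim0, fun l => l.elim0, fun l => l.elim0⟩⟩
    rw [h1, Finset.card_singleton, Matrix.det_of_isUpperTriangular]
    · simp
    · intro i j hij
      have : (j : ℕ) < i := hij
      simp only [Matrix.of_apply, Nat.cast_eq_zero]
      exact Nat.choose_eq_zero_of_lt (by lia)
  | succ a ih =>
    rw [card_chainsBelow_succ, Nat.cast_sum,
      Finset.sum_congr rfl fun s hs => ih s (mem_monotoneBelow.1 hs).2]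
    refine sum_monotoneBelow_alternating
      (fun i x => fun j : Fin b => ((x + (a + j)).choose (x + i) : ℚ))
      (fun i x => fun j : Fin b => ((x + (a + 1 + j)).choose (x + i) : ℚ)) ?_ ?_
      Matrix.detRowAlternating μ hμ
    · intro m
      ext j
      have := sum_Icc_choose_diagonal_zero (a + j) m
      rw [Finset.sum_apply, show m + (a + 1 + (j : ℕ)) = m + (a + j) + 1 by ring]
      exact_mod_cast this
    · intro i l m hlm
      ext j
      have := sum_Icc_choose_diagonal_succ (a + j) i l m hlm
      rw [Finset.sum_apply, Pi.sub_apply, eq_sub_iff_add_eq,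
        show m + (a + 1 + (j : ℕ)) = m + (a + j) + 1 by ring]
      exact_mod_cast this

theorem det_descFactorial_add (a b : ℕ) :
    (Matrix.of fun j i : Fin b => ((a + j : ℕ).descFactorial i : ℚ)).det =
      ∏ j : Fin b, ((j : ℕ).factorial : ℚ) := by
  have h := Matrix.det_eval_matrixOfPolynomials_eq_det_vandermonde
    (fun j : Fin b => ((j : ℚ) + a)) (fun i => descPochhammer ℚ i)
    (fun i => descPochhammer_natDegree ℚ i) (fun i => monic_descPochhammer ℚ i)
  rw [Matrix.det_vandermonde_add] at h
  have h2 : ∀ j i : Fin b, (descPochhammer ℚ i).eval ((j : ℚ) + a) =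
      ((a + j : ℕ).descFactorial i : ℚ) := by
    intro j i
    rw [← descPochhammer_eval_eq_descFactorial]
    push_cast
    rw [add_comm]
  simp only [h2] at h
  rw [← h]
  cases b with
  | zero => simp
  | succ b =>
    rw [Matrix.det_vandermonde_id_eq_superFactorial, ← Nat.prod_range_succ_factorial,
      Fin.prod_univ_eq_prod_range (fun j => ((j.factorial : ℕ) : ℚ)), Nat.cast_prod]

theorem det_choose_box (a b c : ℕ) :
    (Matrix.of fun i j : Fin b => ((c + (a + j)).choose (c + i) : ℚ)).det =
      ∏ j : Fin b, (((a + c + j).factorial * (j : ℕ).factorial : ℚ) /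
        ((c + j).factorial * (a + j).factorial)) := by
  have entry : ∀ i j : ℕ, ((c + (a + j)).choose (c + i) : ℚ) =
      (((c + i).factorial : ℚ)⁻¹) * (((a + c + j).factorial / (a + j).factorial : ℚ) *
        ((a + j).descFactorial i : ℚ)) := by
    intro i j
    have pos (n : ℕ) : (n.factorial : ℚ) ≠ 0 := Nat.cast_ne_zero.2 n.factorial_ne_zero
    by_cases hij : i ≤ a + j
    · have h1 := Nat.factorial_mul_descFactorial hij
      have h2 := Nat.choose_mul_factorial_mul_factorial (show c + i ≤ c + (a + j) by lia)
      rw [show c + (a + j) - (c + i) = a + j - i by lia,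
        show (c + (a + j)).factorial = (a + c + j).factorial by congr 1; ring] at h2
      have h1' : ((a + j - i).factorial : ℚ) * (a + j).descFactorial i = (a + j).factorial := by
        exact_mod_cast h1
      have h2' : ((c + (a + j)).choose (c + i) : ℚ) * (c + i).factorial * (a + j - i).factorial =
        (a + c + j).factorial := by exact_mod_cast h2
      have := pos (a + j)
      have := pos (c + i)
      field_simp
      rw [← h1', ← h2']
      ring
    · rw [Nat.choose_eq_zero_of_lt (by lia), Nat.descFactorial_eq_zero_iff_lt.2 (by lia)]
      simp
  have hm : (Matrix.of fun i j : Fin b => ((c + (a + j)).choose (c + i) : ℚ)) =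
      Matrix.of fun i j : Fin b => (((c + i).factorial : ℚ)⁻¹) *
        (Matrix.of fun i j : Fin b => ((a + c + j).factorial / (a + j).factorial : ℚ) *
          (Matrix.of fun j i : Fin b => ((a + j : ℕ).descFactorial i : ℚ)).transpose i j) i j := by
    ext i j
    exact entry i j
  rw [hm, Matrix.det_mul_column, Matrix.det_mul_row, Matrix.det_transpose, det_descFactorial_add,
    ← Finset.prod_mul_distrib, ← Finset.prod_mul_distrib]
  refine Finset.prod_congr rfl fun j _ => ?_
  ring

open Finset in
theorem prod_box_telescope (a b c : ℕ) :
    ∏ i ∈ range a, ∏ j ∈ range b, ∏ k ∈ range c,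
        ((i + j + k + 2 : ℚ) / (i + j + k + 1 : ℚ)) =
      ∏ j ∈ range b, (((a + c + j).factorial * j.factorial : ℚ) /
        ((c + j).factorial * (a + j).factorial)) := by
  rw [prod_comm]
  refine prod_congr rfl fun j _ => ?_
  have inner (i : ℕ) : ∏ k ∈ range c, ((i + j + k + 2 : ℚ) / (i + j + k + 1 : ℚ)) =
      (i + j + c + 1) / (i + j + 1) := by
    have h1 : (i + j + 1 : ℚ) ≠ 0 := by positivity
    induction c with
    | zero => simp [h1]
    | succ c ih =>
      have h2 : (i + j + c + 1 : ℚ) ≠ 0 := by positivity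
      rw [prod_range_succ, ih]
      push_cast
      field_simp
      ring
  simp only [inner]
  have pos (n : ℕ) : (n.factorial : ℚ) ≠ 0 := Nat.cast_ne_zero.2 n.factorial_ne_zero
  induction a with
  | zero =>
    have := pos j
    have := pos (c + j)
    simp only [range_zero, prod_empty, zero_add]
    field_simp
  | succ a ih =>
    rw [prod_range_succ, ih, show a + 1 + c + j = (a + c + j) + 1 by ring,
      show a + 1 + j = (a + j) + 1 by ring, Nat.factorial_succ, Nat.factorial_succ]
    have := pos (c + j)
    have := pos (a + j)
    have h1 : (a + j + 1 : ℚ) ≠ 0 := by positivity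
    push_cast
    field_simp
    ring

theorem StrictMono.add_sub_le {b : ℕ} {s : Fin b → ℕ} (hs : StrictMono s) {i j : Fin b}
    (hij : i ≤ j) : s i + (j - i : ℕ) ≤ s j := by
  obtain ⟨j, hj⟩ := j
  have hij' : (i : ℕ) ≤ j := hij
  clear hij
  induction j, hij' using Nat.le_induction with
  | base => simp
  | succ j h ih =>
    have h1 := ih (by lia)
    have h2 : s ⟨j, by lia⟩ < s ⟨j + 1, hj⟩ := hs (by simp)
    simp only at h1 ⊢
    lia

open Finset in
theorem card_strict_eq_card_chainsBelow (a b c : ℕ) :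
    Fintype.card {S : Fin a → (Fin b → Fin (b + c)) //
        (∀ l : Fin a, ∀ i j : Fin b, i < j → S l i < S l j) ∧
        (∀ l l' : Fin a, l ≤ l' → ∀ i, S l i ≤ S l' i)} =
      #(chainsBelow a (fun _ : Fin b => c)) := by
  rw [Fintype.card_subtype]
  have strict {S : Fin a → Fin b → Fin (b + c)} (h : ∀ l : Fin a, ∀ i j, i < j → S l i < S l j)
      (l : Fin a) : StrictMono fun i => (S l i : ℕ) := fun i j hij => h l i j hij
  have lower {S : Fin a → Fin b → Fin (b + c)} (h : ∀ l : Fin a, ∀ i j, i < j → S l i < S l j)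
      (l : Fin a) (i : Fin b) : (i : ℕ) ≤ S l i := by
    have := (strict h l).add_sub_le (i := ⟨0, i.pos⟩) (j := i) (Nat.zero_le _)
    simp only at this
    lia
  refine card_bij (fun S _ l i => (S l i : ℕ) - i) ?_ ?_ ?_
  · intro S hS
    obtain ⟨h1, h2⟩ := (mem_filter.1 hS).2
    refine mem_chainsBelow.2 ⟨fun l i => ?_, fun l l' hl i => ?_, fun l i j hij => ?_⟩
    · have hb : b - 1 < b := Nat.sub_one_lt_of_lt i.isLt
      have := (strict h1 l).add_sub_le (i := i) (j := ⟨b - 1, hb⟩)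
        (Nat.le_sub_one_of_lt i.isLt)
      have := (S l ⟨b - 1, hb⟩).isLt
      simp only at *
      lia
    · exact Nat.sub_le_sub_right (h2 l l' hl i) _
    · have h3 := (strict h1 l).add_sub_le hij
      have h4 : (i : ℕ) ≤ j := hij
      simp only at h3 ⊢
      lia
  · intro S hS T hT hST
    have hS1 := (mem_filter.1 hS).2.1
    have hT1 := (mem_filter.1 hT).2.1
    ext l i
    have h1 := congrFun (congrFun hST l) i
    have h2 := lower hS1 l i
    have h3 := lower hT1 l i
    lia
  · intro T hT
    obtain ⟨h1, h2, h3⟩ := mem_chainsBelow.1 hT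
    have bound (l : Fin a) (i : Fin b) : T l i + i < b + c := by
      have := h1 l i
      have := i.isLt
      lia
    refine ⟨fun l i => ⟨T l i + i, bound l i⟩, ?_, ?_⟩
    · refine mem_filter.2 ⟨mem_univ _, fun l i j hij => ?_, fun l l' hl i => ?_⟩
      · have := h3 l hij.le
        have h4 : (i : ℕ) < j := hij
        rw [Fin.lt_def]
        simp only
        lia
      · exact Nat.add_le_add_right (h2 hl i) _
    · ext l i
      exact Nat.add_sub_cancel _ _


/-- the set `PP(a,b,c)` of weakly increasing `a`-tuples
`(s_1 ≤ … ≤ s_a)` of `b`-element subsets of `{1,…,b+c}` (each subset encoded by its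
strictly increasing enumeration, and ordered pointwise) has cardinality equal to the
MacMahon box formula `∏_{i=1}^{a} ∏_{j=1}^{b} ∏_{k=1}^{c} (i+j+k-1)/(i+j+k-2)`. -/
theorem card_PP_eq_macmahon (a b c : ℕ) :
    (Fintype.card {S : Fin a → (Fin b → Fin (b + c)) //
        (∀ l : Fin a, ∀ i j : Fin b, i < j → S l i < S l j) ∧
        (∀ l l' : Fin a, l ≤ l' → ∀ i, S l i ≤ S l' i)} : ℚ)
      = ∏ i ∈ Finset.range a, ∏ j ∈ Finset.range b, ∏ k ∈ Finset.range c,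
          ((i + j + k + 2 : ℚ) / (i + j + k + 1 : ℚ)) := by
  rw [card_strict_eq_card_chainsBelow, card_chainsBelow_eq_det a _ monotone_const, det_choose_box,
    prod_box_telescope]
  exact Fin.prod_univ_eq_prod_range (fun j => ((a + c + j).factorial * j.factorial : ℚ) /
    ((c + j).factorial * (a + j).factorial)) b
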